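/- arXiv:2202.03129 — 6 statements merged into one kernel-verified Lean document; each statement's English description precedes it below -/
import Mathlib

section
/- Let k ≥ 1, n ≥ 1, A > 0, σ > 0, and ε > 0. Let v, v' ∈ ℝ^k be two vectors with nonnegative entries each summing to 1 (the local belief/vote vectors of the differing client), and let u ∈ ℝ^k be arbitrary (the scaled aggregate of the other n−1 clients' outputs, which is the same under both neighboring model sets). Let μ = N_k(u + A·v, σ²A²) and μ' = N_k(u + A·v', σ²A²). Then for every measurable set R ⊆ ℝ^k, μ(R) ≤ e^ε · μ'(R) + δ, where δ = Φ(1/(√2·σ) − ε·σ/√2) − e^ε · Φ(−1/(√2·σ) − ε·σ/√2). (This is Theorem 1: with full participation p = 1, the over-the-air ensemble inference mechanism, whose output given the participating models is Gaussian with mean A·Σᵢ fᵢ(x) and per-coordinate variance σ²A², is (ε,δ)-differentially private at the local-model level.) -/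
open MeasureTheory ProbabilityTheory

/-- CDF of the standard normal distribution `N(0,1)`. -/
noncomputable def stdNormalCDF (t : ℝ) : ℝ := ((gaussianReal 0 1) (Set.Iic t)).toReal

/-- Product Gaussian measure on `ℝ^k` with mean vector `x` and common per-coordinate
variance `s` (i.e. `N_k(x, s)` with variance parameter `s`). -/
noncomputable def gaussPi (k : ℕ) (x : Fin k → ℝ) (s : NNReal) : Measure (Fin k → ℝ) :=
  Measure.pi fun j => gaussianReal (x j) s

/-- Hockey-stick divergence `D_α(μ‖ν) = sup_{S measurable} (μ(S) - α·ν(S))`. -/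
noncomputable def hsDiv {X : Type*} [MeasurableSpace X] (α : ℝ) (μ ν : Measure X) : ℝ :=
  ⨆ S : {S : Set X // MeasurableSet S}, ((μ S.1).toReal - α * (ν S.1).toReal)

/-- The characteristic function of a product of real Gaussian measures of common variance. -/
lemma charFunDual_pi_gaussianReal {ι : Type*} [Fintype ι] [DecidableEq ι] (m : ι → ℝ) (s : NNReal)
    (L : StrongDual ℝ (ι → ℝ)) :
    charFunDual (Measure.pi fun j => gaussianReal (m j) s) L =
      Complex.exp (((∑ j, m j * L (Pi.single j 1) : ℝ) : ℂ) * Complex.I -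
        ((s * (∑ j, L (Pi.single j 1) ^ 2) / 2 : ℝ) : ℂ)) := by
  rw [charFunDual_pi]
  have key (j : ι) : charFunDual (gaussianReal (m j) s) (L.comp (.single ℝ (fun _ => ℝ) j)) =
      Complex.exp (((m j * L (Pi.single j 1) : ℝ) : ℂ) * Complex.I -
        ((s * L (Pi.single j 1) ^ 2 / 2 : ℝ) : ℂ)) := by
    rw [charFunDual_eq_charFun_map_one, gaussianReal_map_continuousLinearMap,
      charFun_gaussianReal]
    have hL : (L.comp (.single ℝ (fun _ => ℝ) j)) (m j) = m j * L (Pi.single j 1) := by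
      have : Pi.single j (m j) = m j • (Pi.single j 1 : ι → ℝ) := by
        rw [← Pi.single_smul]; simp
      simp [this]
    rw [hL]
    congr 1
    simp [Real.coe_toNNReal _ (sq_nonneg _)]
    ring
  simp_rw [key]
  rw [← Complex.exp_sum, Finset.sum_sub_distrib, ← Finset.sum_mul, ← Complex.ofReal_sum,
    ← Complex.ofReal_sum, Finset.mul_sum, Finset.sum_div]

/-- A Gaussian vector with independent coordinates of variance `s` is obtained from a real Gaussian
variable, moved along a vector `w`, by adding a suitable independent Gaussian noise. -/
lemma map_prod_pi_gaussianReal {ι : Type*} [Fintype ι] (m w : ι → ℝ) (s : NNReal) (a θ β : ℝ)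
    (h : 2 * β - β ^ 2 * ∑ j, w j ^ 2 = θ ^ 2) :
    ((gaussianReal a s).prod (Measure.pi fun _ : ι => gaussianReal 0 s)).map
      (fun p => m + ((p.1 * θ) • w + p.2 - (β * ∑ j, w j * p.2 j) • w)) =
    Measure.pi fun j => gaussianReal (m j + a * θ * w j) s := by
  classical
  let G : ℝ × (ι → ℝ) →L[ℝ] (ι → ℝ) :=
    (θ • ContinuousLinearMap.fst ℝ ℝ (ι → ℝ)).smulRight w + ContinuousLinearMap.snd ℝ ℝ (ι → ℝ) -
      ((β • ∑ j, w j • ContinuousLinearMap.proj (R := ℝ) (φ := fun _ : ι => ℝ) j).comp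
        (ContinuousLinearMap.snd ℝ ℝ (ι → ℝ))).smulRight w
  have hG (p) : G p = (p.1 * θ) • w + p.2 - (β * ∑ j, w j * p.2 j) • w := by
    simp [G, mul_comm θ]
  simp_rw [← hG]
  have hcomp : (fun p => m + G p) = (m + ·) ∘ G := rfl
  rw [hcomp, ← Measure.map_map (by fun_prop) (by fun_prop)]
  have : IsProbabilityMeasure
      (((gaussianReal a s).prod (Measure.pi fun _ : ι => gaussianReal 0 s)).map G) :=
    Measure.isProbabilityMeasure_map (by fun_prop)
  have : IsProbabilityMeasure
      ((((gaussianReal a s).prod (Measure.pi fun _ : ι => gaussianReal 0 s)).map G).map (m + ·)) :=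
    Measure.isProbabilityMeasure_map (by fun_prop)
  refine Measure.ext_of_charFunDual (funext fun L => ?_)
  have hLx (x : ι → ℝ) : L x = ∑ j, x j * L (Pi.single j 1) := by
    conv_lhs => rw [pi_eq_sum_univ' x, map_sum]
    simp [Pi.single]
  rw [charFunDual_map_const_add, charFunDual_map, charFunDual_prod, charFunDual_pi_gaussianReal,
    charFunDual_pi_gaussianReal, charFunDual_eq_charFun_map_one,
    gaussianReal_map_continuousLinearMap, charFun_gaussianReal, ← Complex.exp_add,
    ← Complex.exp_add]
  have h1 (t : ℝ) : ((L.comp G).comp (.inl ℝ ℝ (ι → ℝ))) t = t * θ * L w := by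
    simp [hG]
  have h2 (j : ι) : ((L.comp G).comp (.inr ℝ ℝ (ι → ℝ))) (Pi.single j 1) =
      L (Pi.single j 1) - β * w j * L w := by
    simp [hG, Pi.single_apply]
  have h3 : ∑ j, (L (Pi.single j 1) - β * w j * L w) ^ 2 =
      ∑ j, L (Pi.single j 1) ^ 2 - (θ * L w) ^ 2 := by
    have : ∀ j, (L (Pi.single j 1) - β * w j * L w) ^ 2 = L (Pi.single j 1) ^ 2
      - 2 * β * L w * (w j * L (Pi.single j 1)) + β ^ 2 * L w ^ 2 * w j ^ 2 := fun j => by ring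
    simp_rw [this]
    rw [Finset.sum_add_distrib, Finset.sum_sub_distrib, ← Finset.mul_sum, ← Finset.mul_sum,
      ← hLx, mul_pow, ← h]
    ring
  have h4 : ∑ j, (m j + a * θ * w j) * L (Pi.single j 1) = L m + a * θ * L w := by
    rw [hLx m, hLx w, Finset.mul_sum, ← Finset.sum_add_distrib]
    exact Finset.sum_congr rfl fun j _ => by ring
  simp_rw [h2, h3, h4, h1]
  congr 1
  simp [Real.coe_toNNReal _ (sq_nonneg _)]
  ring

/-- Upper tails of a real Gaussian measure in terms of the standard normal distribution function. -/
lemma gaussianReal_Ici_toReal (a c τ : ℝ) (hτ : 0 < τ) :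
    (gaussianReal a (τ ^ 2).toNNReal (Set.Ici c)).toReal = stdNormalCDF ((a - c) / τ) := by
  have hmap : gaussianReal a (τ ^ 2).toNNReal =
      ((gaussianReal 0 1).map (τ * ·)).map (a - ·) := by
    rw [gaussianReal_map_const_mul, gaussianReal_map_const_sub]
    congr 1
    · simp
    · ext; simp [Real.coe_toNNReal _ (sq_nonneg _)]
  rw [hmap, Measure.map_map (by fun_prop) (by fun_prop),
    Measure.map_apply (by fun_prop) measurableSet_Ici, stdNormalCDF]
  congr 2
  ext x
  simp only [Set.mem_preimage, Function.comp_apply, Set.mem_Ici, Set.mem_Iic]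
  rw [le_div_iff₀ hτ]
  constructor <;> intro h <;> linarith

/-- The hockey-stick divergence of two real Gaussian measures of the same variance
at distance `D`. -/
lemma gaussianReal_toReal_le (D τ ε : ℝ) (hD : 0 < D) (hτ : 0 < τ) {R : Set ℝ}
    (hR : MeasurableSet R) :
    (gaussianReal D (τ ^ 2).toNNReal R).toReal ≤
      Real.exp ε * (gaussianReal 0 (τ ^ 2).toNNReal R).toReal +
        (stdNormalCDF (D / (2 * τ) - ε * τ / D) -
          Real.exp ε * stdNormalCDF (-(D / (2 * τ)) - ε * τ / D)) := by
  have hs : (τ ^ 2).toNNReal ≠ 0 := by simp [hτ.ne']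
  have hint (a : ℝ) (S : Set ℝ) : (gaussianReal a (τ ^ 2).toNNReal S).toReal =
      ∫ x in S, gaussianPDFReal a (τ ^ 2).toNNReal x := by
    rw [gaussianReal_apply_eq_integral _ hs, ENNReal.toReal_ofReal]
    exact setIntegral_nonneg_of_ae (ae_of_all _ (gaussianPDFReal_nonneg _ _))
  set g : ℝ → ℝ := fun x => gaussianPDFReal D (τ ^ 2).toNNReal x -
    Real.exp ε * gaussianPDFReal 0 (τ ^ 2).toNNReal x with hg
  have hi (a : ℝ) : Integrable (gaussianPDFReal a (τ ^ 2).toNNReal) :=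
    integrable_gaussianPDFReal _ _
  have hgS (S : Set ℝ) : ∫ x in S, g x = (gaussianReal D (τ ^ 2).toNNReal S).toReal -
      Real.exp ε * (gaussianReal 0 (τ ^ 2).toNNReal S).toReal := by
    rw [hint, hint, hg, integral_sub (hi D).restrict ((hi 0).restrict.const_mul _),
      integral_const_mul]
  have hset : {x | 0 ≤ g x} = Set.Ici (D / 2 + ε * τ ^ 2 / D) := by
    ext x
    simp only [hg, Set.mem_ofPred_eq, Set.mem_Ici, gaussianPDFReal, sub_nonneg,
      Real.coe_toNNReal _ (sq_nonneg τ)]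
    rw [mul_left_comm, mul_le_mul_iff_right₀ (by positivity), ← Real.exp_add, Real.exp_le_exp]
    have e : -(x - D) ^ 2 / (2 * τ ^ 2) - (ε + -(x - 0) ^ 2 / (2 * τ ^ 2)) =
        D / τ ^ 2 * (x - (D / 2 + ε * τ ^ 2 / D)) := by
      field_simp
      ring
    rw [← sub_nonneg, e, mul_nonneg_iff_of_pos_left (by positivity), sub_nonneg]
  have hle := setIntegral_le_nonneg hR (f := g) (μ := volume)
    ((stronglyMeasurable_gaussianPDFReal _ _).sub
      ((stronglyMeasurable_gaussianPDFReal _ _).const_mul _))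
    ((hi D).sub ((hi 0).const_mul _))
  rw [hset, hgS, hgS, gaussianReal_Ici_toReal _ _ _ hτ, gaussianReal_Ici_toReal _ _ _ hτ] at hle
  have e1 : (D - (D / 2 + ε * τ ^ 2 / D)) / τ = D / (2 * τ) - ε * τ / D := by
    field_simp
    ring
  have e2 : (0 - (D / 2 + ε * τ ^ 2 / D)) / τ = -(D / (2 * τ)) - ε * τ / D := by
    field_simp
    ring
  rw [e1, e2] at hle
  linarith

/-- An `(ε, δ)`-type inequality between two measures is preserved by adding independent
randomness and post-processing. -/
lemma toReal_map_prod_le {X Y Z : Type*} [MeasurableSpace X] [MeasurableSpace Y]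
    [MeasurableSpace Z] {P Q : Measure X} [IsFiniteMeasure P] [IsFiniteMeasure Q]
    {N : Measure Y} [IsProbabilityMeasure N] {f : X × Y → Z} (hf : Measurable f) {c δ : ℝ}
    (h : ∀ S, MeasurableSet S → (P S).toReal ≤ c * (Q S).toReal + δ)
    {R : Set Z} (hR : MeasurableSet R) :
    ((P.prod N).map f R).toReal ≤ c * ((Q.prod N).map f R).toReal + δ := by
  have hS : MeasurableSet (f ⁻¹' R) := hf hR
  have key (M : Measure X) [IsFiniteMeasure M] :
      ((M.prod N).map f R).toReal = ∫ y, (M ((fun x => (x, y)) ⁻¹' (f ⁻¹' R))).toReal ∂N ∧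
      Integrable (fun y => (M ((fun x => (x, y)) ⁻¹' (f ⁻¹' R))).toReal) N := by
    have hm : Measurable fun y => M ((fun x => (x, y)) ⁻¹' (f ⁻¹' R)) :=
      measurable_measure_prodMk_right hS
    constructor
    · rw [Measure.map_apply hf hR, Measure.prod_apply_symm hS,
        integral_toReal hm.aemeasurable (ae_of_all _ fun _ => measure_lt_top _ _)]
    · refine Integrable.of_bound hm.ennreal_toReal.aestronglyMeasurable (M Set.univ).toReal
        (ae_of_all _ fun y => ?_)
      rw [Real.norm_of_nonneg ENNReal.toReal_nonneg]
      exact ENNReal.toReal_mono (measure_ne_top _ _) (measure_mono (Set.subset_univ _))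
  obtain ⟨hP, hPi⟩ := key P
  obtain ⟨hQ, hQi⟩ := key Q
  calc _ = ∫ y, (P ((fun x => (x, y)) ⁻¹' (f ⁻¹' R))).toReal ∂N := hP
    _ ≤ ∫ y, (c * (Q ((fun x => (x, y)) ⁻¹' (f ⁻¹' R))).toReal + δ) ∂N :=
      integral_mono hPi ((hQi.const_mul c).add (integrable_const δ))
        fun y => h _ (measurable_prodMk_right hS)
    _ = _ := by
      rw [integral_add (hQi.const_mul c) (integrable_const δ), integral_const_mul, hQ]
      simp

/-- Two probability vectors are at squared Euclidean distance at most `2`. -/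
lemma sum_sub_sq_le_two {ι : Type*} [Fintype ι] {v v' : ι → ℝ} (hv : ∀ j, 0 ≤ v j)
    (hv' : ∀ j, 0 ≤ v' j) (hvsum : ∑ j, v j = 1) (hv'sum : ∑ j, v' j = 1) :
    ∑ j, (v j - v' j) ^ 2 ≤ 2 := by
  have h1 (j : ι) : v j ≤ 1 :=
    hvsum ▸ Finset.single_le_sum (fun i _ => hv i) (Finset.mem_univ j)
  have h2 (j : ι) : v' j ≤ 1 :=
    hv'sum ▸ Finset.single_le_sum (fun i _ => hv' i) (Finset.mem_univ j)
  calc ∑ j, (v j - v' j) ^ 2 ≤ ∑ j, (v j + v' j) := Finset.sum_le_sum fun j _ => by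
        nlinarith [hv j, hv' j, h1 j, h2 j, mul_nonneg (hv j) (hv' j)]
    _ = 2 := by rw [Finset.sum_add_distrib, hvsum, hv'sum]; norm_num

/-- The hockey-stick bound for two Gaussian vectors with independent coordinates of the same
variance whose means are at Euclidean distance at most `D`. -/
lemma pi_gaussianReal_toReal_le {ι : Type*} [Fintype ι] (m w : ι → ℝ) (D τ ε : ℝ) (hD : 0 < D)
    (hτ : 0 < τ) (hw : ∑ j, w j ^ 2 ≤ D ^ 2) {R : Set (ι → ℝ)} (hR : MeasurableSet R) :
    ((Measure.pi fun j => gaussianReal (m j + w j) (τ ^ 2).toNNReal) R).toReal ≤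
      Real.exp ε * ((Measure.pi fun j => gaussianReal (m j) (τ ^ 2).toNNReal) R).toReal +
        (stdNormalCDF (D / (2 * τ) - ε * τ / D) -
          Real.exp ε * stdNormalCDF (-(D / (2 * τ)) - ε * τ / D)) := by
  obtain ⟨β, hβ⟩ : ∃ β : ℝ, 2 * β - β ^ 2 * ∑ j, w j ^ 2 = D⁻¹ ^ 2 := by
    set r := Real.sqrt (1 - (∑ j, w j ^ 2) / D ^ 2)
    have hr : 0 ≤ r := Real.sqrt_nonneg _
    have hr2 : r ^ 2 = 1 - (∑ j, w j ^ 2) / D ^ 2 :=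
      Real.sq_sqrt (sub_nonneg.2 ((div_le_one (by positivity)).2 hw))
    have hW : ∑ j, w j ^ 2 = D ^ 2 * (1 - r ^ 2) := by
      rw [hr2]
      field_simp
      ring
    refine ⟨1 / (D ^ 2 * (1 + r)), ?_⟩
    rw [hW]
    field_simp
    ring
  have hP := map_prod_pi_gaussianReal m w (τ ^ 2).toNNReal D D⁻¹ β hβ
  have hQ := map_prod_pi_gaussianReal m w (τ ^ 2).toNNReal 0 D⁻¹ β hβ
  simp only [mul_inv_cancel₀ hD.ne', one_mul, zero_mul, add_zero] at hP hQ
  rw [← hP, ← hQ]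
  exact toReal_map_prod_le (by fun_prop)
    (fun S hS => gaussianReal_toReal_le D τ ε hD hτ hS) hR

/-- **Theorem 1** (full participation `p = 1`): the over-the-air ensemble mechanism, whose
output given the models is Gaussian with mean `u + A·v` (resp. `u + A·v'` for the neighboring
model set) and per-coordinate variance `σ²A²`, is `(ε,δ)`-DP with
`δ = Φ(1/(√2σ) - εσ/√2) - e^ε Φ(-1/(√2σ) - εσ/√2)`. -/
theorem stmt0 (k n : ℕ) (hk : 1 ≤ k) (hn : 1 ≤ n)
    (A σ ε : ℝ) (hA : 0 < A) (hσ : 0 < σ) (hε : 0 < ε)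
    (v v' : Fin k → ℝ)
    (hv : ∀ j, 0 ≤ v j) (hv' : ∀ j, 0 ≤ v' j)
    (hvsum : ∑ j, v j = 1) (hv'sum : ∑ j, v' j = 1)
    (u : Fin k → ℝ)
    (μ μ' : Measure (Fin k → ℝ))
    (hμ : μ = gaussPi k (fun j => u j + A * v j) ((σ ^ 2 * A ^ 2).toNNReal))
    (hμ' : μ' = gaussPi k (fun j => u j + A * v' j) ((σ ^ 2 * A ^ 2).toNNReal)) :
    ∀ R : Set (Fin k → ℝ), MeasurableSet R →
      (μ R).toReal ≤ Real.exp ε * (μ' R).toReal +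
        (stdNormalCDF (1 / (Real.sqrt 2 * σ) - ε * σ / Real.sqrt 2) -
          Real.exp ε * stdNormalCDF (-(1 / (Real.sqrt 2 * σ)) - ε * σ / Real.sqrt 2)) := by
  intro R hR
  have hw : ∑ j, (A * (v j - v' j)) ^ 2 ≤ (Real.sqrt 2 * A) ^ 2 := by
    simp_rw [mul_pow]
    rw [← Finset.mul_sum, Real.sq_sqrt zero_le_two, mul_comm (2 : ℝ)]
    exact mul_le_mul_of_nonneg_left (sum_sub_sq_le_two hv hv' hvsum hv'sum) (sq_nonneg A)
  have h := pi_gaussianReal_toReal_le (fun j => u j + A * v' j) _ (Real.sqrt 2 * A) (σ * A) ε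
    (by positivity) (by positivity) hw hR
  have e1 : Real.sqrt 2 * A / (2 * (σ * A)) = 1 / (Real.sqrt 2 * σ) := by
    field_simp
    exact Real.sq_sqrt zero_le_two
  have e2 : ε * (σ * A) / (Real.sqrt 2 * A) = ε * σ / Real.sqrt 2 := by
    field_simp
  have e3 (j : Fin k) : u j + A * v' j + A * (v j - v' j) = u j + A * v j := by ring
  simp_rw [e1, e2, e3, mul_pow] at h
  rw [hμ, hμ']
  exact h
end

section
/- Let k ≥ 1, n ≥ 1, A > 0, σ > 0, and p ∈ (0,1). Let v_1, …, v_n ∈ ℝ^k and v_1' ∈ ℝ^k all have nonnegative entries summing to 1. For each nonempty subset S of {1,…,n}, set w(S) = p^{|S|}(1−p)^{n−|S|} / (1 − (1−p)^n), so that Σ_{S ≠ ∅} w(S) = 1. Define the mixture probability measures on ℝ^k: μ = Σ_{S ≠ ∅} w(S) · N_k(A·Σ_{i∈S} v_i, σ²A²) and μ' = Σ_{S ≠ ∅} w(S) · N_k(A·(Σ_{i∈S} v_i − 𝟙[1∈S]·v_1 + 𝟙[1∈S]·v_1'), σ²A²). Then for every ε' > 0 and every measurable set R ⊆ ℝ^k,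 μ(R) ≤ e^{ε'} · μ'(R) + δ', where η = p/(1 − (1−p)^n), ε = log(1 + (e^{ε'} − 1)/η), and δ' = η · (Φ(1/(√2·σ) − ε·σ/√2) − e^ε · Φ(−1/(√2·σ) − ε·σ/√2)). (This is Theorem 2: if each client independently participates with probability p < 1, then the subsampled over-the-air ensemble inference mechanism is (ε', δ')-differentially private.) -/
open MeasureTheory ProbabilityTheory

/-- Expectation of `F U` when every element of `s` belongs to the random set `U`
independently with probability `p`. -/
noncomputable def bernoulliSetMean {ι : Type*} (p : ℝ) (s : Finset ι) (F : Finset ι → ℝ) : ℝ :=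
  ∑ U ∈ s.powerset, p ^ U.card * (1 - p) ^ (s.card - U.card) * F U

section BernoulliSetMean

variable {ι : Type*} {p : ℝ} {s : Finset ι} {F G : Finset ι → ℝ}

lemma bernoulliSetMean_empty (p : ℝ) (F : Finset ι → ℝ) : bernoulliSetMean p ∅ F = F ∅ := by
  simp [bernoulliSetMean]

lemma bernoulliSetMean_insert [DecidableEq ι] (p : ℝ) {a : ι} (ha : a ∉ s) (F : Finset ι → ℝ) :
    bernoulliSetMean p (insert a s) F
      = p * bernoulliSetMean p s (fun U ↦ F (insert a U))
        + (1 - p) * bernoulliSetMean p s F := by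
  unfold bernoulliSetMean
  rw [Finset.sum_powerset_insert ha, add_comm, Finset.mul_sum, Finset.mul_sum]
  congr 1
  · refine Finset.sum_congr rfl fun U hU ↦ ?_
    have haU : a ∉ U := fun h ↦ ha (Finset.mem_powerset.1 hU h)
    rw [Finset.card_insert_of_notMem ha, Finset.card_insert_of_notMem haU,
      Nat.add_sub_add_right]
    ring
  · refine Finset.sum_congr rfl fun U hU ↦ ?_
    have hUs := Finset.card_le_card (Finset.mem_powerset.1 hU)
    rw [Finset.card_insert_of_notMem ha, Nat.succ_sub hUs, pow_succ]
    ring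

lemma bernoulliSetMean_mono (hp0 : 0 ≤ p) (hp1 : p ≤ 1) (h : ∀ U ⊆ s, F U ≤ G U) :
    bernoulliSetMean p s F ≤ bernoulliSetMean p s G := by
  have hq : 0 ≤ 1 - p := sub_nonneg.2 hp1
  refine Finset.sum_le_sum fun U hU ↦ ?_
  have := h U (Finset.mem_powerset.1 hU)
  gcongr

lemma bernoulliSetMean_congr (p : ℝ) (h : ∀ U ⊆ s, F U = G U) :
    bernoulliSetMean p s F = bernoulliSetMean p s G :=
  Finset.sum_congr rfl fun U hU ↦ by rw [h U (Finset.mem_powerset.1 hU)]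

lemma bernoulliSetMean_affine (p : ℝ) (s : Finset ι) (F : Finset ι → ℝ) (c d : ℝ) :
    bernoulliSetMean p s (fun U ↦ c * F U + d) = c * bernoulliSetMean p s F + d := by
  have hone : ∑ U ∈ s.powerset, p ^ U.card * (1 - p) ^ (s.card - U.card) = 1 := by
    rw [Finset.sum_pow_mul_eq_add_pow]
    simp
  calc bernoulliSetMean p s (fun U ↦ c * F U + d)
      = c * bernoulliSetMean p s F
        + (∑ U ∈ s.powerset, p ^ U.card * (1 - p) ^ (s.card - U.card)) * d := by
        rw [bernoulliSetMean, bernoulliSetMean, Finset.mul_sum, Finset.sum_mul,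
          ← Finset.sum_add_distrib]
        exact Finset.sum_congr rfl fun U _ ↦ by ring
    _ = _ := by rw [hone, one_mul]

lemma sum_nonempty_eq_bernoulliSetMean_sub [DecidableEq ι] (p : ℝ) (s : Finset ι)
    (F : Finset ι → ℝ) :
    ∑ U ∈ s.powerset.filter (fun U ↦ U.Nonempty),
        p ^ U.card * (1 - p) ^ (s.card - U.card) * F U
      = bernoulliSetMean p s F - (1 - p) ^ s.card * F ∅ := by
  have h : s.powerset.filter (fun U ↦ U.Nonempty) = s.powerset.erase ∅ := by
    ext U
    simp [Finset.nonempty_iff_ne_empty, and_comm]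
  rw [h, Finset.sum_erase_eq_sub (Finset.empty_mem_powerset s)]
  simp [bernoulliSetMean]

/-- A Bernoulli random subset `U` can be coupled with the same random subset conditioned on being
nonempty so that the latter is `U` itself or `U` with one element added. -/
lemma bernoulliSetMean_le_of_insert [DecidableEq ι] (hp0 : 0 ≤ p) (hp1 : p ≤ 1)
    (hself : ∀ U ⊆ s, U.Nonempty → G U ≤ F U)
    (hinsert : ∀ U ⊆ s, ∀ i ∈ s, i ∉ U → G U ≤ F (insert i U)) :
    (1 - (1 - p) ^ s.card) * bernoulliSetMean p s G
      ≤ bernoulliSetMean p s F - (1 - p) ^ s.card * F ∅ := by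
  induction s using Finset.induction_on with
  | empty => simp [bernoulliSetMean_empty]
  | insert a s ha ih =>
    have hq : 0 ≤ 1 - p := sub_nonneg.2 hp1
    have hsub {U : Finset ι} (hU : U ⊆ s) : U ⊆ insert a s := hU.trans (Finset.subset_insert a s)
    have ih' := ih (fun U hU ↦ hself U (hsub hU))
      (fun U hU i hi ↦ hinsert U (hsub hU) i (Finset.mem_insert_of_mem hi))
    have h₁ : bernoulliSetMean p s (fun U ↦ G (insert a U))
        ≤ bernoulliSetMean p s (fun U ↦ F (insert a U)) :=
      bernoulliSetMean_mono hp0 hp1 fun U hU ↦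
        hself _ (Finset.insert_subset_insert a hU) (Finset.insert_nonempty a U)
    have h₂ : bernoulliSetMean p s G ≤ bernoulliSetMean p s (fun U ↦ F (insert a U)) :=
      bernoulliSetMean_mono hp0 hp1 fun U hU ↦
        hinsert U (hsub hU) a (Finset.mem_insert_self a s) fun h ↦ ha (hU h)
    rw [bernoulliSetMean_insert p ha, bernoulliSetMean_insert p ha,
      Finset.card_insert_of_notMem ha, pow_succ]
    have hr0 : 0 ≤ (1 - p) ^ s.card := pow_nonneg hq _
    have hr1 : (1 - p) ^ s.card ≤ 1 := pow_le_one₀ hq (by linarith)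
    generalize (1 - p) ^ s.card = r at *
    have e₁ := mul_le_mul_of_nonneg_left h₁
      (mul_nonneg hp0 (sub_nonneg.2 (mul_le_one₀ hr1 hq (by linarith))))
    have e₂ := mul_le_mul_of_nonneg_left h₂ (mul_nonneg hp0 (mul_nonneg hr0 hq))
    have e₃ := mul_le_mul_of_nonneg_left ih' hq
    linarith

end BernoulliSetMean

section Gaussian

open Finset

variable {k : ℕ}

instance isProbabilityMeasure_gaussPi (x : Fin k → ℝ) (s : NNReal) :
    IsProbabilityMeasure (gaussPi k x s) := by
  unfold gaussPi
  infer_instance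

lemma gaussPi_eq_withDensity (x : Fin k → ℝ) {s : NNReal} (hs : s ≠ 0) :
    gaussPi k x s
      = volume.withDensity fun z ↦ ENNReal.ofReal (∏ j, gaussianPDFReal (x j) s (z j)) := by
  refine Measure.pi_eq fun S hS ↦ ?_
  have hint : Integrable (fun z : Fin k → ℝ ↦ ∏ j, gaussianPDFReal (x j) s (z j)) volume :=
    Integrable.fintype_prod fun j ↦ integrable_gaussianPDFReal (x j) s
  rw [withDensity_apply _ (MeasurableSet.univ_pi hS),
    ← ofReal_integral_eq_lintegral_ofReal hint.integrableOn
      (ae_of_all _ fun z ↦ prod_nonneg fun j _ ↦ gaussianPDFReal_nonneg _ _ _),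
    volume_pi, Measure.restrict_pi_pi,
    integral_fintype_prod_eq_prod (fun j z ↦ gaussianPDFReal (x j) s z),
    ENNReal.ofReal_prod_of_nonneg fun j _ ↦
      integral_nonneg fun z ↦ gaussianPDFReal_nonneg _ _ _]
  exact prod_congr rfl fun j _ ↦ (gaussianReal_apply_eq_integral _ hs _).symm

lemma gaussPi_map_sum_mul (c x : Fin k → ℝ) (s : NNReal) :
    (gaussPi k x s).map (fun z ↦ ∑ j, c j * z j)
      = gaussianReal (∑ j, c j * x j) ((∑ j, c j ^ 2).toNNReal * s) := by
  have hmeas : Measurable fun z : Fin k → ℝ ↦ ∑ j, c j * z j := by fun_prop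
  have := Measure.isProbabilityMeasure_map (μ := gaussPi k x s) hmeas.aemeasurable
  refine Measure.ext_of_charFun (funext fun t ↦ ?_)
  rw [charFun_apply_real, integral_map hmeas.aemeasurable (by fun_prop), charFun_gaussianReal]
  have hsplit (z : Fin k → ℝ) : Complex.exp (t * ((∑ j, c j * z j : ℝ) : ℂ) * Complex.I)
      = ∏ j, Complex.exp (((t * c j : ℝ) : ℂ) * (z j : ℂ) * Complex.I) := by
    rw [← Complex.exp_sum]
    push_cast
    rw [mul_sum, sum_mul]
    congr 1
    exact sum_congr rfl fun j _ ↦ by ring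
  simp_rw [hsplit, gaussPi]
  rw [integral_fintype_prod_eq_prod
    (fun j (z : ℝ) ↦ Complex.exp (((t * c j : ℝ) : ℂ) * (z : ℂ) * Complex.I))]
  simp_rw [← charFun_apply_real, charFun_gaussianReal]
  rw [← Complex.exp_sum]
  congr 1
  have hc : (((∑ j, c j ^ 2).toNNReal : ℝ) : ℂ) = ∑ j, (c j : ℂ) ^ 2 := by
    rw [Real.coe_toNNReal _ (sum_nonneg fun j _ ↦ sq_nonneg _)]
    push_cast
    rfl
  rw [sum_sub_distrib, NNReal.coe_mul, Complex.ofReal_mul, hc]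
  push_cast
  simp only [mul_sum, sum_mul, sum_div]
  congr 1 <;> exact sum_congr rfl fun j _ ↦ by ring

lemma gaussianReal_Ici_toReal_s1 (m t : ℝ) {V : NNReal} (hV : V ≠ 0) :
    (gaussianReal m V (Set.Ici t)).toReal = stdNormalCDF ((m - t) / Real.sqrt V) := by
  have hpos : 0 < Real.sqrt V := Real.sqrt_pos.2 (by positivity)
  have hmap : (gaussianReal 0 1).map (fun z ↦ m - Real.sqrt V * z) = gaussianReal m V := by
    rw [← Function.comp_def (fun y ↦ m - y) (fun z ↦ Real.sqrt V * z),
      ← Measure.map_map (by fun_prop) (by fun_prop), gaussianReal_map_const_mul,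
      gaussianReal_map_const_sub]
    congr 1
    · simp
    · ext
      simp
  rw [← hmap, Measure.map_apply (by fun_prop) measurableSet_Ici, stdNormalCDF]
  congr 2
  ext z
  simp only [Set.mem_preimage, Set.mem_Ici, Set.mem_Iic, le_div_iff₀ hpos]
  constructor <;> intro h <;> linarith

lemma gaussPi_map_tail (x : Fin (k + 1) → ℝ) (s : NNReal) :
    (gaussPi (k + 1) x s).map Fin.tail = gaussPi k (Fin.tail x) s := by
  have hmeas : Measurable (Fin.tail : (Fin (k + 1) → ℝ) → Fin k → ℝ) :=
    measurable_pi_lambda _ fun j ↦ measurable_pi_apply j.succ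
  refine (Measure.pi_eq fun S hS ↦ ?_).symm
  have hpre : Fin.tail ⁻¹' Set.univ.pi S
      = Set.univ.pi (Fin.cons Set.univ S : Fin (k + 1) → Set ℝ) := by
    ext z
    simp [Set.mem_pi, Fin.forall_fin_succ, Fin.tail]
  rw [Measure.map_apply hmeas (MeasurableSet.univ_pi hS), hpre, gaussPi, Measure.pi_pi,
    Fin.prod_univ_succ]
  simp [Fin.tail]

lemma exp_mul_prod_gaussianPDFReal_le_iff (x y z : Fin k → ℝ) {s : NNReal} (hs : s ≠ 0) (ε : ℝ) :
    Real.exp ε * ∏ j, gaussianPDFReal (y j) s (z j) ≤ ∏ j, gaussianPDFReal (x j) s (z j)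
      ↔ s * ε + ∑ j, (x j ^ 2 - y j ^ 2) / 2 ≤ ∑ j, (x j - y j) * z j := by
  have hs' : (0 : ℝ) < s := by positivity
  have hconst : 0 < ∏ _j : Fin k, (Real.sqrt (2 * Real.pi * s))⁻¹ :=
    prod_pos fun _ _ ↦ by positivity
  simp only [gaussianPDFReal, prod_mul_distrib, ← Real.exp_sum]
  rw [mul_left_comm, mul_le_mul_iff_right₀ hconst, ← Real.exp_add, Real.exp_le_exp,
    ← mul_le_mul_iff_right₀ hs', ← sub_nonneg, ← sub_nonneg (b := _ + _)]
  refine iff_of_eq (congrArg (0 ≤ ·) ?_)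
  have hx (x : Fin k → ℝ) : (s : ℝ) * ∑ j, -(z j - x j) ^ 2 / (2 * s)
      = ∑ j, -(z j - x j) ^ 2 / 2 := by
    rw [mul_sum]
    exact sum_congr rfl fun j _ ↦ by field_simp
  rw [mul_add, hx, hx, add_comm, sub_add_eq_sub_sub, sub_add_eq_sub_sub_swap,
    ← sum_sub_distrib, ← sum_sub_distrib]
  congr 1
  exact sum_congr rfl fun j _ ↦ by ring

/-- The hockey-stick divergence is attained on the superlevel set of the likelihood ratio. -/
lemma withDensity_toReal_sub_le {X : Type*} [MeasurableSpace X] {ν μ₁ μ₂ : Measure X}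
    [IsFiniteMeasure μ₁] [IsFiniteMeasure μ₂] {f g : X → ℝ} {c : ℝ} (hc : 0 ≤ c)
    (hμ₁ : μ₁ = ν.withDensity fun z ↦ ENNReal.ofReal (f z))
    (hμ₂ : μ₂ = ν.withDensity fun z ↦ ENNReal.ofReal (g z)) {H R : Set X}
    (hH : MeasurableSet H) (hR : MeasurableSet R) (hfg : ∀ z, z ∈ H ↔ c * g z ≤ f z) :
    (μ₁ R).toReal - c * (μ₂ R).toReal ≤ (μ₁ H).toReal - c * (μ₂ H).toReal := by
  have key (T : Set X) (hT : MeasurableSet T) :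
      ENNReal.ofReal c * μ₂ T = ∫⁻ z in T, ENNReal.ofReal (c * g z) ∂ν := by
    rw [hμ₂, withDensity_apply _ hT, ← lintegral_const_mul' _ _ ENNReal.ofReal_ne_top]
    exact lintegral_congr fun z ↦ (ENNReal.ofReal_mul hc).symm
  have hle : μ₁ (R \ H) ≤ ENNReal.ofReal c * μ₂ (R \ H) := by
    rw [key _ (hR.diff hH), hμ₁, withDensity_apply _ (hR.diff hH)]
    exact setLIntegral_mono' (hR.diff hH) fun z hz ↦
      ENNReal.ofReal_le_ofReal (not_le.1 (mt (hfg z).2 hz.2)).le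
  have hge : ENNReal.ofReal c * μ₂ (H \ R) ≤ μ₁ (H \ R) := by
    rw [key _ (hH.diff hR), hμ₁, withDensity_apply _ (hH.diff hR)]
    exact setLIntegral_mono' (hH.diff hR) fun z hz ↦
      ENNReal.ofReal_le_ofReal ((hfg z).1 hz.1)
  have hle' := ENNReal.toReal_mono (by finiteness) hle
  have hge' := ENNReal.toReal_mono (by finiteness) hge
  rw [ENNReal.toReal_mul, ENNReal.toReal_ofReal hc] at hle' hge'
  simp only [← measureReal_def] at hle' hge' ⊢
  rw [← measureReal_inter_add_sdiff (μ := μ₁) (s := R) hH,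
    ← measureReal_inter_add_sdiff (μ := μ₂) (s := R) hH,
    ← measureReal_inter_add_sdiff (μ := μ₁) (s := H) hR,
    ← measureReal_inter_add_sdiff (μ := μ₂) (s := H) hR,
    Set.inter_comm H R]
  linarith

lemma gaussPi_toReal_le_of_sum_sq_eq (x y : Fin k → ℝ) {s : NNReal} (hs : s ≠ 0) {D : ℝ}
    (hD : 0 < D) (hxy : ∑ j, (x j - y j) ^ 2 = D ^ 2) (ε : ℝ) {R : Set (Fin k → ℝ)}
    (hR : MeasurableSet R) :
    (gaussPi k x s R).toReal ≤ Real.exp ε * (gaussPi k y s R).toReal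
      + (stdNormalCDF (D / (2 * Real.sqrt s) - ε * Real.sqrt s / D)
        - Real.exp ε * stdNormalCDF (-(D / (2 * Real.sqrt s)) - ε * Real.sqrt s / D)) := by
  set t : ℝ := s * ε + ∑ j, (x j ^ 2 - y j ^ 2) / 2 with ht
  have hmeas : Measurable fun z : Fin k → ℝ ↦ ∑ j, (x j - y j) * z j := by fun_prop
  have h := withDensity_toReal_sub_le (Real.exp_pos ε).le (gaussPi_eq_withDensity x hs)
    (gaussPi_eq_withDensity y hs) (hmeas measurableSet_Ici) hR
    (H := (fun z : Fin k → ℝ ↦ ∑ j, (x j - y j) * z j) ⁻¹' Set.Ici t)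
    fun z ↦ (exp_mul_prod_gaussianPDFReal_le_iff x y z hs ε).symm
  have hs' : (0 : ℝ) < Real.sqrt s := Real.sqrt_pos.2 (by positivity)
  have hV : (∑ j, (x j - y j) ^ 2).toNNReal * s ≠ 0 := by
    rw [hxy]
    positivity
  have hsqrt : Real.sqrt ((∑ j, (x j - y j) ^ 2).toNNReal * s : NNReal) = D * Real.sqrt s := by
    rw [hxy, NNReal.coe_mul, Real.coe_toNNReal _ (sq_nonneg D), Real.sqrt_mul (sq_nonneg D),
      Real.sqrt_sq hD.le]
  have hsq : (s : ℝ) = Real.sqrt s ^ 2 := (Real.sq_sqrt s.2).symm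
  rw [← Measure.map_apply hmeas measurableSet_Ici, ← Measure.map_apply hmeas measurableSet_Ici,
    gaussPi_map_sum_mul, gaussPi_map_sum_mul, gaussianReal_Ici_toReal_s1 _ _ hV,
    gaussianReal_Ici_toReal_s1 _ _ hV, hsqrt] at h
  have hx : ∑ j, (x j - y j) * x j - t = D ^ 2 / 2 - s * ε := by
    rw [ht, ← hxy, sub_add_eq_sub_sub_swap, ← sum_sub_distrib, sum_div]
    congr 1
    exact sum_congr rfl fun j _ ↦ by ring
  have hy : ∑ j, (x j - y j) * y j - t = -(D ^ 2 / 2) - s * ε := by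
    rw [ht, ← hxy, sub_add_eq_sub_sub_swap, ← sum_sub_distrib, sum_div, ← sum_neg_distrib]
    congr 1
    exact sum_congr rfl fun j _ ↦ by ring
  have ex : (D ^ 2 / 2 - s * ε) / (D * Real.sqrt s)
      = D / (2 * Real.sqrt s) - ε * Real.sqrt s / D := by
    rw [hsq, Real.sqrt_sq hs'.le]
    field_simp
  have ey : (-(D ^ 2 / 2) - s * ε) / (D * Real.sqrt s)
      = -(D / (2 * Real.sqrt s)) - ε * Real.sqrt s / D := by
    rw [hsq, Real.sqrt_sq hs'.le]
    field_simp
  rw [hx, hy, ex, ey] at h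
  linarith

/-- Privacy profile of the Gaussian mechanism with sensitivity `D`. -/
lemma gaussPi_toReal_le (x y : Fin k → ℝ) {s : NNReal} (hs : s ≠ 0) {D : ℝ}
    (hD : 0 < D) (hxy : ∑ j, (x j - y j) ^ 2 ≤ D ^ 2) (ε : ℝ) {R : Set (Fin k → ℝ)}
    (hR : MeasurableSet R) :
    (gaussPi k x s R).toReal ≤ Real.exp ε * (gaussPi k y s R).toReal
      + (stdNormalCDF (D / (2 * Real.sqrt s) - ε * Real.sqrt s / D)
        - Real.exp ε * stdNormalCDF (-(D / (2 * Real.sqrt s)) - ε * Real.sqrt s / D)) := by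
  have hmeas : Measurable (Fin.tail : (Fin (k + 1) → ℝ) → Fin k → ℝ) :=
    measurable_pi_lambda _ fun j ↦ measurable_pi_apply j.succ
  have hlift (a : ℝ) (x : Fin k → ℝ) :
      gaussPi k x s R = gaussPi (k + 1) (Fin.cons a x) s (Fin.tail ⁻¹' R) := by
    rw [← Measure.map_apply hmeas hR, gaussPi_map_tail, Fin.tail_cons]
  rw [hlift (Real.sqrt (D ^ 2 - ∑ j, (x j - y j) ^ 2)) x, hlift 0 y]
  refine gaussPi_toReal_le_of_sum_sq_eq _ _ hs hD ?_ ε (hmeas hR)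
  simp [Fin.sum_univ_succ, Real.sq_sqrt (sub_nonneg.2 hxy)]

end Gaussian

lemma sum_sq_le_one_of_sum_eq_one {κ : Type*} [Fintype κ] {a : κ → ℝ} (ha : ∀ j, 0 ≤ a j)
    (hasum : ∑ j, a j = 1) : ∑ j, a j ^ 2 ≤ 1 := by
  rw [← hasum]
  refine Finset.sum_le_sum fun j _ ↦ ?_
  have : a j ≤ 1 := hasum ▸ Finset.single_le_sum (fun i _ ↦ ha i) (Finset.mem_univ j)
  nlinarith [ha j]

lemma sum_sub_sq_le_two_of_sum_eq_one {κ : Type*} [Fintype κ] {a b : κ → ℝ}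
    (ha : ∀ j, 0 ≤ a j) (hasum : ∑ j, a j = 1) (hb : ∀ j, 0 ≤ b j) (hbsum : ∑ j, b j = 1) :
    ∑ j, (a j - b j) ^ 2 ≤ 2 := by
  calc ∑ j, (a j - b j) ^ 2 ≤ ∑ j, (a j ^ 2 + b j ^ 2) :=
        Finset.sum_le_sum fun j _ ↦ by nlinarith [mul_nonneg (ha j) (hb j)]
    _ ≤ 2 := by
        rw [Finset.sum_add_distrib]
        linarith [sum_sq_le_one_of_sum_eq_one ha hasum, sum_sq_le_one_of_sum_eq_one hb hbsum]

/-- Privacy amplification for a Bernoulli subsample of `insert a s` conditioned on being nonempty,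
when the two mechanisms `F` and `F'` differ only on sets containing `a`. -/
lemma bernoulliSetMean_amplification {ι : Type*} [DecidableEq ι] {p α δ : ℝ} (hp0 : 0 < p)
    (hp1 : p < 1) (hα : 1 ≤ α) {s : Finset ι} {a : ι} (ha : a ∉ s) {F F' : Finset ι → ℝ}
    (hF : ∀ U ⊆ s, F' U = F U)
    (hreplace : ∀ U ⊆ s, F (insert a U) ≤ α * F' (insert a U) + δ)
    (hremove : ∀ U ⊆ s, F (insert a U) ≤ α * F U + δ)
    (hswap : ∀ U ⊆ s, ∀ i ∈ s, i ∉ U → F (insert a U) ≤ α * F (insert i U) + δ) :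
    bernoulliSetMean p (insert a s) F - (1 - p) ^ (s.card + 1) * F ∅
      ≤ (1 + p / (1 - (1 - p) ^ (s.card + 1)) * (α - 1))
          * (bernoulliSetMean p (insert a s) F' - (1 - p) ^ (s.card + 1) * F' ∅)
        + p * δ := by
  have h₁ : bernoulliSetMean p s (fun U ↦ F (insert a U))
      ≤ α * bernoulliSetMean p s (fun U ↦ F' (insert a U)) + δ := by
    rw [← bernoulliSetMean_affine]
    exact bernoulliSetMean_mono hp0.le hp1.le hreplace
  have h₂ := bernoulliSetMean_le_of_insert (s := s) (G := fun U ↦ F (insert a U))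
    (F := fun U ↦ α * F U + δ) hp0.le hp1.le (fun U hU _ ↦ hremove U hU) hswap
  have hq : 0 < 1 - p := sub_pos.2 hp1
  have hr0 : 0 < (1 - p) ^ s.card := pow_pos hq _
  have hr1 : (1 - p) ^ s.card ≤ 1 := pow_le_one₀ hq.le (by linarith)
  rw [bernoulliSetMean_affine] at h₂
  rw [bernoulliSetMean_insert p ha, bernoulliSetMean_insert p ha,
    bernoulliSetMean_congr p hF, hF ∅ (Finset.empty_subset s), pow_succ]
  generalize (1 - p) ^ s.card = r at *
  generalize bernoulliSetMean p s (fun U ↦ F (insert a U)) = X at *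
  generalize bernoulliSetMean p s (fun U ↦ F' (insert a U)) = Y at *
  generalize bernoulliSetMean p s F = B at *
  have hZ : 0 < 1 - r * (1 - p) := by nlinarith
  have hα0 : 0 < α := by linarith
  set η := p / (1 - r * (1 - p)) with hη
  have hη0 : 0 ≤ η := by positivity
  have hpη : η * (1 - r * (1 - p)) = p := by rw [hη]; field_simp
  have e₁ := mul_le_mul_of_nonneg_left h₁
    (mul_nonneg hp0.le (add_nonneg zero_le_one (mul_nonneg hη0 (sub_nonneg.2 hα))))
  have e₂ := mul_le_mul_of_nonneg_left h₂
    (mul_nonneg (mul_nonneg hη0 (sub_nonneg.2 hα)) hq.le)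
  refine le_of_mul_le_mul_left ?_ hα0
  have hpr : η * (1 - p) * (1 - r) = p * (1 - η) := by
    linear_combination hpη
  have e₃ : η * (α - 1) * (1 - p) * ((1 - r) * X) = (α - 1) * p * (1 - η) * X := by
    linear_combination (α - 1) * X * hpr
  have e₄ : η * (α - 1) * (1 - p) * (α * B + δ - r * (α * F ∅ + δ))
      = η * (α - 1) * (1 - p) * α * (B - r * F ∅) + (α - 1) * p * (1 - η) * δ := by
    linear_combination (α - 1) * δ * hpr
  linarith

/-- **Theorem 2** (subsampling with participation probability `p < 1`): the subsampled
over-the-air ensemble mechanism, a mixture over nonempty participant sets `S` with weights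
`w(S) = p^{|S|}(1-p)^{n-|S|}/(1-(1-p)^n)` of Gaussians with means `A·∑_{i∈S} vᵢ` (resp. with
client 1's contribution `v₁` replaced by `v₁'`) and per-coordinate variance `σ²A²`, is
`(ε',δ')`-DP with `η = p/(1-(1-p)^n)`, `ε = log(1 + (e^{ε'}-1)/η)` and
`δ' = η(Φ(1/(√2σ) - εσ/√2) - e^ε Φ(-1/(√2σ) - εσ/√2))`. -/
theorem stmt1 (k n : ℕ) (hk : 1 ≤ k) (hn : 1 ≤ n)
    (A σ p : ℝ) (hA : 0 < A) (hσ : 0 < σ) (hp0 : 0 < p) (hp1 : p < 1)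
    (v : Fin n → Fin k → ℝ) (v1' : Fin k → ℝ)
    (hv : ∀ i j, 0 ≤ v i j) (hvsum : ∀ i, ∑ j, v i j = 1)
    (hv' : ∀ j, 0 ≤ v1' j) (hv'sum : ∑ j, v1' j = 1)
    (w : Finset (Fin n) → ℝ)
    (hw : ∀ S, w S = p ^ S.card * (1 - p) ^ (n - S.card) / (1 - (1 - p) ^ n))
    (μ μ' : Measure (Fin k → ℝ))
    (hμ : μ = ∑ S ∈ Finset.univ.filter (fun S : Finset (Fin n) => S.Nonempty),
        ENNReal.ofReal (w S) •
          gaussPi k (fun j => A * ∑ i ∈ S, v i j) ((σ ^ 2 * A ^ 2).toNNReal))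
    (hμ' : μ' = ∑ S ∈ Finset.univ.filter (fun S : Finset (Fin n) => S.Nonempty),
        ENNReal.ofReal (w S) •
          gaussPi k (fun j => A * ((∑ i ∈ S, v i j)
              - (if (⟨0, hn⟩ : Fin n) ∈ S then v ⟨0, hn⟩ j else 0)
              + (if (⟨0, hn⟩ : Fin n) ∈ S then v1' j else 0)))
            ((σ ^ 2 * A ^ 2).toNNReal)) :
    ∀ ε' : ℝ, 0 < ε' → ∀ R : Set (Fin k → ℝ), MeasurableSet R →
      (μ R).toReal ≤ Real.exp ε' * (μ' R).toReal +
        (p / (1 - (1 - p) ^ n)) *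
          (stdNormalCDF (1 / (Real.sqrt 2 * σ)
              - Real.log (1 + (Real.exp ε' - 1) / (p / (1 - (1 - p) ^ n))) * σ / Real.sqrt 2)
            - Real.exp (Real.log (1 + (Real.exp ε' - 1) / (p / (1 - (1 - p) ^ n)))) *
              stdNormalCDF (-(1 / (Real.sqrt 2 * σ))
                - Real.log (1 + (Real.exp ε' - 1) / (p / (1 - (1 - p) ^ n))) * σ
                  / Real.sqrt 2)) := by
  intro ε' hε' R hR
  subst hμ hμ'
  set a : Fin n := ⟨0, hn⟩ with ha_def
  set s : Finset (Fin n) := Finset.univ.erase a with hs_def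
  have ha : a ∉ s := Finset.notMem_erase a _
  have hins : insert a s = Finset.univ := Finset.insert_erase (Finset.mem_univ a)
  have hcard : s.card + 1 = n := by
    rw [← Finset.card_insert_of_notMem ha, hins, Finset.card_univ, Fintype.card_fin]
  have hq : 0 < 1 - p := sub_pos.2 hp1
  have hZ : 0 < 1 - (1 - p) ^ n := sub_pos.2 (pow_lt_one₀ hq.le (by linarith) (by lia))
  set V : NNReal := (σ ^ 2 * A ^ 2).toNNReal with hV_def
  have hV : V ≠ 0 := (Real.toNNReal_pos.2 (by positivity)).ne'
  have hsqrtV : Real.sqrt V = σ * A := by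
    rw [hV_def, Real.coe_toNNReal _ (by positivity), ← mul_pow, Real.sqrt_sq (by positivity)]
  set η := p / (1 - (1 - p) ^ n) with hη_def
  have hη : 0 < η := div_pos hp0 hZ
  have hα1 : 1 ≤ 1 + (Real.exp ε' - 1) / η := by
    have : 0 ≤ (Real.exp ε' - 1) / η := div_nonneg (sub_nonneg.2 (Real.one_le_exp hε'.le)) hη.le
    linarith
  set ε := Real.log (1 + (Real.exp ε' - 1) / η) with hε_def
  have hexp : Real.exp ε = 1 + (Real.exp ε' - 1) / η := Real.exp_log (by linarith)
  set δ := stdNormalCDF (1 / (Real.sqrt 2 * σ) - ε * σ / Real.sqrt 2)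
    - Real.exp ε * stdNormalCDF (-(1 / (Real.sqrt 2 * σ)) - ε * σ / Real.sqrt 2) with hδ_def
  have h2 : 0 < Real.sqrt 2 := by positivity
  have hgauss (x y d : Fin k → ℝ) (hxy : ∀ j, x j - y j = d j) (hd : ∑ j, d j ^ 2 ≤ 2) :
      (gaussPi k (fun j ↦ A * x j) V R).toReal
        ≤ Real.exp ε * (gaussPi k (fun j ↦ A * y j) V R).toReal + δ := by
    have hD : ∑ j, (A * x j - A * y j) ^ 2 ≤ (Real.sqrt 2 * A) ^ 2 := by
      rw [mul_pow, Real.sq_sqrt zero_le_two]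
      calc ∑ j, (A * x j - A * y j) ^ 2 = (∑ j, d j ^ 2) * A ^ 2 := by
            rw [Finset.sum_mul]
            exact Finset.sum_congr rfl fun j _ ↦ by rw [← hxy]; ring
        _ ≤ 2 * A ^ 2 := by gcongr
    have h := gaussPi_toReal_le _ _ hV (mul_pos h2 hA) hD ε hR
    have e₁ : Real.sqrt 2 * A / (2 * (σ * A)) = 1 / (Real.sqrt 2 * σ) := by
      field_simp
      rw [Real.sq_sqrt zero_le_two]
    have e₂ : ε * (σ * A) / (Real.sqrt 2 * A) = ε * σ / Real.sqrt 2 := by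
      field_simp
    rwa [hsqrtV, e₁, e₂] at h
  set F : Finset (Fin n) → ℝ := fun S ↦
    (gaussPi k (fun j ↦ A * ∑ i ∈ S, v i j) V R).toReal with hF_def
  set F' : Finset (Fin n) → ℝ := fun S ↦
    (gaussPi k (fun j ↦ A * ((∑ i ∈ S, v i j) - (if a ∈ S then v a j else 0)
      + (if a ∈ S then v1' j else 0))) V R).toReal with hF'_def
  have hmix (m : Finset (Fin n) → Fin k → ℝ) :
      ((∑ S ∈ Finset.univ.filter (fun S : Finset (Fin n) => S.Nonempty),
        ENNReal.ofReal (w S) • gaussPi k (m S) V) R).toReal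
        = (bernoulliSetMean p (insert a s) (fun S ↦ (gaussPi k (m S) V R).toReal)
            - (1 - p) ^ (s.card + 1) * (gaussPi k (m ∅) V R).toReal) / (1 - (1 - p) ^ n) := by
    have hcard' : (insert a s).card = n := by rw [Finset.card_insert_of_notMem ha, hcard]
    have h := sum_nonempty_eq_bernoulliSetMean_sub p (insert a s)
      (fun S ↦ (gaussPi k (m S) V R).toReal)
    rw [hcard'] at h
    rw [hcard, ← h, hins, Finset.powerset_univ, Finset.sum_div, Measure.finsetSum_apply,
      ENNReal.toReal_sum fun S _ ↦ by rw [Measure.smul_apply, smul_eq_mul]; finiteness]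
    refine Finset.sum_congr rfl fun S _ ↦ ?_
    have hwS : 0 ≤ w S := by rw [hw]; positivity
    rw [Measure.smul_apply, smul_eq_mul, ENNReal.toReal_mul, ENNReal.toReal_ofReal hwS, hw]
    ring
  have hnotMem {U : Finset (Fin n)} (hU : U ⊆ s) : a ∉ U := fun h ↦ ha (hU h)
  have key := bernoulliSetMean_amplification (δ := δ) hp0 hp1 (hα1.trans_eq hexp.symm) ha
    (F := F) (F' := F')
    (fun U hU ↦ by simp [hF_def, hF'_def, hnotMem hU])
    (fun U hU ↦ hgauss _ _ (fun j ↦ v a j - v1' j)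
      (fun j ↦ by simp only [Finset.mem_insert_self, if_true]; ring)
      (sum_sub_sq_le_two_of_sum_eq_one (hv a) (hvsum a) hv' hv'sum))
    (fun U hU ↦ hgauss _ _ (fun j ↦ v a j)
      (fun j ↦ by rw [Finset.sum_insert (hnotMem hU)]; ring)
      ((sum_sq_le_one_of_sum_eq_one (hv a) (hvsum a)).trans one_le_two))
    (fun U hU i _ hiU ↦ hgauss _ _ (fun j ↦ v a j - v i j)
      (fun j ↦ by rw [Finset.sum_insert (hnotMem hU), Finset.sum_insert hiU]; ring)
      (sum_sub_sq_le_two_of_sum_eq_one (hv a) (hvsum a) (hv i) (hvsum i)))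
  have hα' : 1 + η * (Real.exp ε - 1) = Real.exp ε' := by
    rw [hexp]
    field_simp
    ring
  rw [hmix, hmix]
  rw [show (1 - p) ^ (s.card + 1) = (1 - p) ^ n by rw [hcard], ← hη_def, hα'] at key
  rw [show (1 - p) ^ (s.card + 1) = (1 - p) ^ n by rw [hcard], div_le_iff₀ hZ]
  refine key.trans_eq ?_
  rw [hη_def]
  field_simp
  rfl
end

section
/- Let C > 0, σ̃ > 0, and ε ∈ ℝ. Let μ be the Gaussian measure on ℝ with mean 0 and variance σ̃², and let ν be the Gaussian measure on ℝ with mean C and variance σ̃². Then the hockey-stick divergence D_{e^ε}(μ‖ν) = sup over measurable sets S ⊆ ℝ of (μ(S) − e^ε · ν(S)) equals exactly Φ(C/(2σ̃) − ε·σ̃/C) − e^ε · Φ(−C/(2σ̃) − ε·σ̃/C). (This is the exact privacy-curve computation underlying the 'only if' direction of the analytical Gaussian mechanism, Lemma 1.) -/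
open MeasureTheory ProbabilityTheory

/-- The CDF of `N(m, σ²)` at `t` is the standard normal CDF at `(t - m) / σ`. -/
lemma gaussianReal_Iic_toReal (m t : ℝ) {σ : ℝ} (hσ : 0 < σ) :
    (gaussianReal m (σ ^ 2).toNNReal (Set.Iic t)).toReal = stdNormalCDF ((t - m) / σ) := by
  have hmap : gaussianReal m (σ ^ 2).toNNReal
      = ((gaussianReal 0 1).map (σ * ·)).map (· + m) := by
    rw [gaussianReal_map_const_mul, gaussianReal_map_add_const]
    congr 1
    · simp
    · ext
      simp [sq_nonneg]
  rw [hmap, Measure.map_map (by fun_prop) (by fun_prop),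
    Measure.map_apply (by fun_prop) measurableSet_Iic, stdNormalCDF]
  congr 2
  ext x
  simp only [Set.mem_preimage, Function.comp_apply, Set.mem_Iic]
  rw [le_div_iff₀ hσ]
  constructor <;> intro h <;> linarith

/-- The likelihood ratio of `N(0, σ²)` to `N(C, σ²)` is at least `e^ε` exactly on a half-line. -/
lemma exp_mul_gaussianPDFReal_le_iff {C σ : ℝ} (ε x : ℝ) (hC : 0 < C) (hσ : 0 < σ) :
    Real.exp ε * gaussianPDFReal C (σ ^ 2).toNNReal x ≤ gaussianPDFReal 0 (σ ^ 2).toNNReal x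
      ↔ x ≤ C / 2 - ε * σ ^ 2 / C := by
  have hc : 0 < (√(2 * Real.pi * σ ^ 2))⁻¹ := by positivity
  simp only [gaussianPDFReal, Real.coe_toNNReal _ (sq_nonneg σ)]
  rw [mul_left_comm, mul_le_mul_iff_right₀ hc, ← Real.exp_add, Real.exp_le_exp]
  have h₁ : -(x - 0) ^ 2 / (2 * σ ^ 2) - (ε + -(x - C) ^ 2 / (2 * σ ^ 2))
      = C / σ ^ 2 * (C / 2 - ε * σ ^ 2 / C - x) := by
    field_simp
    ring
  rw [← sub_nonneg, h₁, mul_nonneg_iff_of_pos_left (by positivity), sub_nonneg]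

/-- The hockey-stick objective on a measurable set is the integral of the difference of
densities. -/
lemma gaussianReal_toReal_sub_mul (a m₁ m₂ : ℝ) {v : NNReal} (hv : v ≠ 0) (S : Set ℝ) :
    (gaussianReal m₁ v S).toReal - a * (gaussianReal m₂ v S).toReal
      = ∫ x in S, (gaussianPDFReal m₁ v x - a * gaussianPDFReal m₂ v x) := by
  rw [integral_sub (integrable_gaussianPDFReal _ _).integrableOn
      ((integrable_gaussianPDFReal _ _).const_mul _).integrableOn, integral_const_mul,
    gaussianReal_apply_eq_integral _ hv, gaussianReal_apply_eq_integral _ hv,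
    ENNReal.toReal_ofReal (integral_nonneg fun x => gaussianPDFReal_nonneg _ _ _),
    ENNReal.toReal_ofReal (integral_nonneg fun x => gaussianPDFReal_nonneg _ _ _)]

/-- **Exact Gaussian privacy curve** (underlying the 'only if' direction of Lemma 1): the
hockey-stick divergence of order `e^ε` between `N(0,σ̃²)` and `N(C,σ̃²)` equals
`Φ(C/(2σ̃) - εσ̃/C) - e^ε Φ(-C/(2σ̃) - εσ̃/C)`. -/
theorem stmt3 (C σt ε : ℝ) (hC : 0 < C) (hσ : 0 < σt) :
    hsDiv (Real.exp ε) (gaussianReal 0 ((σt ^ 2).toNNReal))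
        (gaussianReal C ((σt ^ 2).toNNReal))
      = stdNormalCDF (C / (2 * σt) - ε * σt / C)
        - Real.exp ε * stdNormalCDF (-(C / (2 * σt)) - ε * σt / C) := by
  have hv : (σt ^ 2).toNNReal ≠ 0 := by simp [hσ.ne']
  have hset : {x | 0 ≤ gaussianPDFReal 0 (σt ^ 2).toNNReal x
      - Real.exp ε * gaussianPDFReal C (σt ^ 2).toNNReal x}
      = Set.Iic (C / 2 - ε * σt ^ 2 / C) := by
    ext x
    simpa only [Set.mem_ofPred_eq, sub_nonneg, Set.mem_Iic]
      using exp_mul_gaussianPDFReal_le_iff ε x hC hσ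
  have hmax : ∀ S : Set ℝ, MeasurableSet S →
      (gaussianReal 0 (σt ^ 2).toNNReal S).toReal
          - Real.exp ε * (gaussianReal C (σt ^ 2).toNNReal S).toReal
        ≤ (gaussianReal 0 (σt ^ 2).toNNReal (Set.Iic (C / 2 - ε * σt ^ 2 / C))).toReal
          - Real.exp ε
            * (gaussianReal C (σt ^ 2).toNNReal (Set.Iic (C / 2 - ε * σt ^ 2 / C))).toReal := by
    intro S hS
    rw [gaussianReal_toReal_sub_mul _ _ _ hv, gaussianReal_toReal_sub_mul _ _ _ hv, ← hset]
    exact setIntegral_le_nonneg hS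
      ((stronglyMeasurable_gaussianPDFReal _ _).sub
        ((stronglyMeasurable_gaussianPDFReal _ _).const_mul _))
      ((integrable_gaussianPDFReal _ _).sub ((integrable_gaussianPDFReal _ _).const_mul _))
  have h₀ : C / (2 * σt) - ε * σt / C = (C / 2 - ε * σt ^ 2 / C - 0) / σt := by
    field_simp
    ring
  have h₁ : -(C / (2 * σt)) - ε * σt / C = (C / 2 - ε * σt ^ 2 / C - C) / σt := by
    field_simp
    ring
  rw [h₀, h₁, ← gaussianReal_Iic_toReal _ _ hσ, ← gaussianReal_Iic_toReal _ _ hσ]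
  refine IsGreatest.csSup_eq ⟨⟨⟨Set.Iic (C / 2 - ε * σt ^ 2 / C), measurableSet_Iic⟩, rfl⟩, ?_⟩
  exact Set.forall_mem_range.2 fun S => hmax S.1 S.2
end

section
/- Let μ and ν be probability measures on a measurable space such that μ is absolutely continuous with respect to ν, with Radon–Nikodym density f = dμ/dν, and let α ≥ 0. Then ∫ max(0, f(z) − α) dν(z) = sup over measurable sets S of (μ(S) − α·ν(S)). In particular, for ε ∈ ℝ and δ ∈ [0,1), one has μ(S) ≤ e^ε · ν(S) + δ for all measurable S if and only if ∫ max(0, f(z) − e^ε) dν(z) ≤ δ. (This is the privacy-profile characterization, Lemma 2: a mechanism is (ε,δ)-DP if and only if the hockey-stick divergence D_{e^ε} between every pair of neighboring output distributions is at most δ.) -/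
open MeasureTheory ProbabilityTheory

section HockeyStick

variable {X : Type*} [MeasurableSpace X] {μ ν : Measure X} [IsFiniteMeasure μ] [IsFiniteMeasure ν]

lemma setIntegral_toReal_rnDeriv_sub_const (hac : μ ≪ ν) (α : ℝ) (S : Set X) :
    ∫ z in S, ((μ.rnDeriv ν z).toReal - α) ∂ν = (μ S).toReal - α * (ν S).toReal := by
  rw [integral_sub Measure.integrable_toReal_rnDeriv.integrableOn (integrable_const α),
    Measure.setIntegral_toReal_rnDeriv hac, setIntegral_const, smul_eq_mul, mul_comm]
  rfl

lemma integrable_max_zero_toReal_rnDeriv_sub_const (α : ℝ) :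
    Integrable (fun z ↦ max 0 ((μ.rnDeriv ν z).toReal - α)) ν :=
  (integrable_zero X ℝ ν).sup (Measure.integrable_toReal_rnDeriv.sub (integrable_const α))

/-- The integral form of the hockey-stick divergence is the largest value of
`μ S - α * ν S`, attained at the superlevel set `{α ≤ dμ/dν}`. -/
lemma isGreatest_integral_max_rnDeriv_sub (hac : μ ≪ ν) (α : ℝ) :
    IsGreatest (Set.range fun S : {S : Set X // MeasurableSet S} ↦
      (μ S.1).toReal - α * (ν S.1).toReal)
      (∫ z, max 0 ((μ.rnDeriv ν z).toReal - α) ∂ν) := by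
  have hint := integrable_max_zero_toReal_rnDeriv_sub_const (μ := μ) (ν := ν) α
  constructor
  · have hS : MeasurableSet {z | α ≤ (μ.rnDeriv ν z).toReal} :=
      measurableSet_le measurable_const (Measure.measurable_rnDeriv μ ν).ennreal_toReal
    refine ⟨⟨_, hS⟩, ?_⟩
    dsimp only
    rw [← setIntegral_toReal_rnDeriv_sub_const hac, ← integral_indicator hS]
    congr 1 with z
    by_cases hz : α ≤ (μ.rnDeriv ν z).toReal
    · simp [Set.indicator, hz]
    · simp [Set.indicator, hz, (not_le.mp hz).le]
  · rintro _ ⟨⟨S, hS⟩, rfl⟩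
    dsimp only
    rw [← setIntegral_toReal_rnDeriv_sub_const hac]
    calc ∫ z in S, ((μ.rnDeriv ν z).toReal - α) ∂ν
        ≤ ∫ z in S, max 0 ((μ.rnDeriv ν z).toReal - α) ∂ν :=
          integral_mono
            (Measure.integrable_toReal_rnDeriv.sub (integrable_const α)).integrableOn
            hint.integrableOn fun z ↦ le_max_right _ _
      _ ≤ ∫ z, max 0 ((μ.rnDeriv ν z).toReal - α) ∂ν :=
          setIntegral_le_integral hint (.of_forall fun z ↦ le_max_left _ _)

end HockeyStick

/-- **Lemma 2** (privacy-profile characterization): for probability measures `μ ≪ ν` with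
density `f = dμ/dν` and `α ≥ 0`, the integral form `∫ max(0, f - α) dν` equals the supremum
form of the hockey-stick divergence; consequently `(ε,δ)`-DP of the pair `(μ,ν)` holds iff
`∫ max(0, f - e^ε) dν ≤ δ`. -/
theorem stmt4 {X : Type*} [MeasurableSpace X] (μ ν : Measure X)
    [IsProbabilityMeasure μ] [IsProbabilityMeasure ν] (hac : μ ≪ ν) (α : ℝ) (hα : 0 ≤ α) :
    (∫ z, max 0 ((μ.rnDeriv ν z).toReal - α) ∂ν) = hsDiv α μ ν ∧
    (∀ ε δ : ℝ, 0 ≤ δ → δ < 1 →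
      ((∀ S : Set X, MeasurableSet S → (μ S).toReal ≤ Real.exp ε * (ν S).toReal + δ) ↔
        (∫ z, max 0 ((μ.rnDeriv ν z).toReal - Real.exp ε) ∂ν) ≤ δ)) := by
  refine ⟨(isGreatest_integral_max_rnDeriv_sub hac α).csSup_eq.symm, fun ε δ _ _ ↦ ?_⟩
  rw [isLUB_le_iff (isGreatest_integral_max_rnDeriv_sub hac (Real.exp ε)).isLUB]
  simp [upperBounds, add_comm]
end

section
/- Let μ₀, μ₁, μ₁' be probability measures on a common measurable space, let η ∈ (0,1], and let α ≥ 1. Set α' = 1 + η(α − 1) and β = α'/α. Then D_{α'}((1−η)μ₀ + η·μ₁ ‖ (1−η)μ₀ + η·μ₁') = η · D_α(μ₁ ‖ (1−β)μ₀ + β·μ₁'), where D_α denotes the hockey-stick divergence. (This is the advanced joint convexity property of the hockey-stick divergence, Lemma 3, used to prove privacy amplification by subsampling.) -/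
open MeasureTheory ProbabilityTheory

/-- **Lemma 3** (advanced joint convexity of the hockey-stick divergence): for `η ∈ (0,1]`,
`α ≥ 1`, `α' = 1 + η(α-1)` and `β = α'/α`,
`D_{α'}((1-η)μ₀ + ημ₁ ‖ (1-η)μ₀ + ημ₁') = η · D_α(μ₁ ‖ (1-β)μ₀ + βμ₁')`. -/
theorem stmt5 {X : Type*} [MeasurableSpace X] (μ₀ μ₁ μ₁' : Measure X)
    [IsProbabilityMeasure μ₀] [IsProbabilityMeasure μ₁] [IsProbabilityMeasure μ₁']
    (η α : ℝ) (hη0 : 0 < η) (hη1 : η ≤ 1) (hα : 1 ≤ α) :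
    hsDiv (1 + η * (α - 1))
        (ENNReal.ofReal (1 - η) • μ₀ + ENNReal.ofReal η • μ₁)
        (ENNReal.ofReal (1 - η) • μ₀ + ENNReal.ofReal η • μ₁')
      = η * hsDiv α μ₁
          (ENNReal.ofReal (1 - (1 + η * (α - 1)) / α) • μ₀
            + ENNReal.ofReal ((1 + η * (α - 1)) / α) • μ₁') := by
  have hα0 : (0 : ℝ) < α := by linarith
  have hα'_nonneg : 0 ≤ 1 + η * (α - 1) := by nlinarith
  have hα'_le : 1 + η * (α - 1) ≤ α := by nlinarith
  have hβ0 : 0 ≤ (1 + η * (α - 1)) / α := div_nonneg hα'_nonneg hα0.le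
  have hβ1 : 0 ≤ 1 - (1 + η * (α - 1)) / α := sub_nonneg.2 ((div_le_one hα0).2 hα'_le)
  have mixture_toReal (a b : ℝ) (ha : 0 ≤ a) (hb : 0 ≤ b) (μ ν : Measure X)
      [IsProbabilityMeasure μ] [IsProbabilityMeasure ν] (S : Set X) :
      ((ENNReal.ofReal a • μ + ENNReal.ofReal b • ν) S).toReal
        = a * (μ S).toReal + b * (ν S).toReal := by
    rw [Measure.add_apply, Measure.smul_apply, Measure.smul_apply, smul_eq_mul, smul_eq_mul,
      ENNReal.toReal_add (by finiteness) (by finiteness), ENNReal.toReal_mul, ENNReal.toReal_mul,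
      ENNReal.toReal_ofReal ha, ENNReal.toReal_ofReal hb]
  unfold hsDiv
  rw [Real.mul_iSup_of_nonneg hη0.le]
  congr 1 with S
  rw [mixture_toReal _ _ (sub_nonneg.2 hη1) hη0.le, mixture_toReal _ _ (sub_nonneg.2 hη1) hη0.le,
    mixture_toReal _ _ hβ1 hβ0]
  field_simp
  ring
end

section
/- Let σ̃ > 0 and ε > 0. The function C ↦ Φ(C/(2σ̃) − ε·σ̃/C) − e^ε · Φ(−C/(2σ̃) − ε·σ̃/C) is monotone nondecreasing on (0, ∞). (This monotonicity of the Gaussian privacy curve in the sensitivity C justifies bounding the privacy loss by its value at the worst-case sensitivity ‖x − x'‖₂ ≤ C in Lemma 1 and Theorem 1.) -/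
open MeasureTheory ProbabilityTheory

lemma stdNormalCDF_eq_integral (t : ℝ) :
    stdNormalCDF t = ∫ x in Set.Iic t, gaussianPDFReal 0 1 x := by
  rw [stdNormalCDF, gaussianReal_apply_eq_integral 0 one_ne_zero, ENNReal.toReal_ofReal]
  exact integral_nonneg fun x => gaussianPDFReal_nonneg 0 1 x

lemma hasDerivAt_stdNormalCDF (t : ℝ) :
    HasDerivAt stdNormalCDF (gaussianPDFReal 0 1 t) t := by
  have hint := integrable_gaussianPDFReal 0 1
  have hcont : Continuous (gaussianPDFReal 0 1) := by
    unfold gaussianPDFReal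
    fun_prop
  have heq : stdNormalCDF =
      fun t => stdNormalCDF 0 + ∫ x in (0 : ℝ)..t, gaussianPDFReal 0 1 x := by
    funext t
    rw [← intervalIntegral.integral_Iic_sub_Iic hint.integrableOn hint.integrableOn,
      stdNormalCDF_eq_integral, stdNormalCDF_eq_integral]
    ring
  rw [heq]
  exact (hcont.integral_hasStrictDerivAt 0 t).hasDerivAt.const_add _

lemma exp_mul_gaussianPDFReal_neg_sub (u v : ℝ) :
    Real.exp (2 * u * v) * gaussianPDFReal 0 1 (-u - v) = gaussianPDFReal 0 1 (u - v) := by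
  simp only [gaussianPDFReal]
  rw [mul_left_comm, ← Real.exp_add]
  congr 2
  push_cast
  ring

lemma hasDerivAt_gaussianPrivacyCurve {σ ε C : ℝ} (hσ : σ ≠ 0) (hC : C ≠ 0) :
    HasDerivAt (fun C : ℝ => stdNormalCDF (C / (2 * σ) - ε * σ / C)
        - Real.exp ε * stdNormalCDF (-(C / (2 * σ)) - ε * σ / C))
      (gaussianPDFReal 0 1 (C / (2 * σ) - ε * σ / C) / σ) C := by
  have hu : HasDerivAt (fun C : ℝ => C / (2 * σ)) (1 / (2 * σ)) C :=
    (hasDerivAt_id C).div_const _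
  have hv : HasDerivAt (fun C : ℝ => ε * σ / C) (-(ε * σ / C ^ 2)) C := by
    simpa only [div_eq_mul_inv, mul_neg] using (hasDerivAt_inv hC).const_mul (ε * σ)
  have h := ((hasDerivAt_stdNormalCDF _).comp C (hu.sub hv)).sub
    (((hasDerivAt_stdNormalCDF _).comp C (hu.neg.sub hv)).const_mul (Real.exp ε))
  refine h.congr_deriv ?_
  have key := exp_mul_gaussianPDFReal_neg_sub (C / (2 * σ)) (ε * σ / C)
  rw [show 2 * (C / (2 * σ)) * (ε * σ / C) = ε by field_simp] at key
  simp only [Pi.sub_apply, Pi.neg_apply]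
  rw [← mul_assoc, key]
  field_simp
  ring

/-- **Monotonicity of the Gaussian privacy curve in the sensitivity**: for fixed `σ̃ > 0` and
`ε > 0`, the function `C ↦ Φ(C/(2σ̃) - εσ̃/C) - e^ε Φ(-C/(2σ̃) - εσ̃/C)` is monotone
nondecreasing on `(0,∞)`. -/
theorem stmt10 (σt ε : ℝ) (hσ : 0 < σt) (hε : 0 < ε) :
    MonotoneOn (fun C : ℝ =>
      stdNormalCDF (C / (2 * σt) - ε * σt / C)
        - Real.exp ε * stdNormalCDF (-(C / (2 * σt)) - ε * σt / C)) (Set.Ioi (0 : ℝ)) := by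
  have hderiv (C : ℝ) (hC : C ∈ Set.Ioi (0 : ℝ)) :=
    hasDerivAt_gaussianPrivacyCurve (ε := ε) hσ.ne' (ne_of_gt hC)
  refine monotoneOn_of_hasDerivWithinAt_nonneg (convex_Ioi 0)
    (fun C hC => (hderiv C hC).continuousAt.continuousWithinAt)
    (fun C hC => (hderiv C (interior_subset hC)).hasDerivWithinAt)
    (fun C _ => div_nonneg (gaussianPDFReal_nonneg 0 1 _) hσ.le)
end
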